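/- arXiv:1807.05913 — 4 statements merged into one kernel-verified Lean document; each statement's English description precedes it below -/
import Mathlib

section
/- For every α > 0 the Riemann–Liouville fractional integral is injective on C([0,T];X): if f ∈ C([0,T];X) and (I^α f)(t) = 0 for all t ∈ [0,T], then f(t) = 0 for all t ∈ [0,T]. -/
open MeasureTheory Set

/-- The Riemann–Liouville fractional integral of order `α` of `f : ℝ → X`:
`(I^α f)(t) = (1/Γ(α)) ∫₀^t (t−s)^{α−1} f(s) ds` (a Bochner integral). -/
noncomputable def RL {X : Type*} [NormedAddCommGroup X] [NormedSpace ℂ X]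
    (α : ℝ) (f : ℝ → X) (t : ℝ) : X :=
  (Real.Gamma α)⁻¹ • ∫ s in (0:ℝ)..t, ((t - s) ^ (α - 1) : ℝ) • f s

noncomputable def rlKer (a x : ℝ) : ℝ := (Ici (0:ℝ)).indicator (fun x => x ^ (a - 1)) x

lemma rlKer_nonneg (a x : ℝ) : 0 ≤ rlKer a x := by
  unfold rlKer
  exact indicator_nonneg (fun y hy => Real.rpow_nonneg hy _) x

lemma rlKer_measurable (a : ℝ) : Measurable (rlKer a) := by
  have : Measurable (fun x : ℝ => x ^ (a - 1)) := by fun_prop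
  exact this.indicator measurableSet_Ici

lemma rl_inner {X : Type*} [NormedAddCommGroup X] [NormedSpace ℝ X]
    (a t s : ℝ) (hs : s ∈ Ioc 0 t) (f : ℝ → X) :
    ∫ u in Ioc 0 t, rlKer a (s - u) • f u = ∫ u in (0:ℝ)..s, ((s - u) ^ (a - 1) : ℝ) • f u := by
  have e : ∀ u, rlKer a (s - u) • f u
      = (Iic s).indicator (fun u => ((s - u) ^ (a - 1) : ℝ) • f u) u := by
    intro u
    by_cases h : u ≤ s
    · simp [rlKer, indicator, h]
    · simp [rlKer, indicator, h]
  simp_rw [e]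
  rw [setIntegral_indicator measurableSet_Iic, intervalIntegral.integral_of_le hs.1.le,
    Ioc_inter_Iic, min_eq_right hs.2]

lemma rl_beta (a b : ℝ) (ha : 0 < a) (hb : 0 < b) (t u : ℝ) (hu : u < t) :
    ∫ s in u..t, (t - s) ^ (b - 1) * (s - u) ^ (a - 1)
      = (t - u) ^ (a + b - 1) * ProbabilityTheory.beta a b := by
  have h1 : ∫ s in u..t, (t - s) ^ (b - 1) * (s - u) ^ (a - 1)
      = ∫ x in (0:ℝ)..(t - u), x ^ (a - 1) * ((t - u) - x) ^ (b - 1) := by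
    have := intervalIntegral.integral_comp_sub_right (a := u) (b := t)
      (fun x => x ^ (a - 1) * ((t - u) - x) ^ (b - 1)) u
    rw [sub_self] at this
    rw [← this]
    congr 1
    ext s
    rw [mul_comm]
    congr 2
    ring
  rw [h1]
  have hp : 0 < t - u := sub_pos.2 hu
  have := Complex.betaIntegral_scaled (a : ℂ) (b : ℂ) hp
  rw [Complex.betaIntegral_eq_Gamma_mul_div _ _ (by simpa) (by simpa)] at this
  have e : (∫ x in (0:ℝ)..(t - u), (x : ℂ) ^ ((a : ℂ) - 1) * (((t - u : ℝ) : ℂ) - x) ^ ((b : ℂ) - 1))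
     = ((∫ x in (0:ℝ)..(t - u), x ^ (a - 1) * ((t - u) - x) ^ (b - 1) : ℝ) : ℂ) := by
    rw [← intervalIntegral.integral_ofReal]
    rw [intervalIntegral.integral_of_le hp.le, intervalIntegral.integral_of_le hp.le]
    refine setIntegral_congr_fun measurableSet_Ioc fun x hx => ?_
    rw [Complex.ofReal_mul, Complex.ofReal_cpow hx.1.le, Complex.ofReal_cpow (sub_nonneg.2 hx.2)]
    push_cast
    rfl
  rw [e] at this
  apply Complex.ofReal_injective
  rw [this, ProbabilityTheory.beta, Complex.ofReal_mul, Complex.ofReal_cpow hp.le,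
    ← Complex.ofReal_add, Complex.Gamma_ofReal, Complex.Gamma_ofReal, Complex.Gamma_ofReal]
  push_cast
  rfl

lemma rl_outer (a b : ℝ) (ha : 0 < a) (hb : 0 < b) (t u : ℝ) (hu : u ∈ Ioo 0 t) :
    ∫ s in Ioc 0 t, rlKer a (s - u) * (t - s) ^ (b - 1)
      = (t - u) ^ (a + b - 1) * ProbabilityTheory.beta a b := by
  have e : ∀ s, rlKer a (s - u) * (t - s) ^ (b - 1)
      = (Ici u).indicator (fun s => (t - s) ^ (b - 1) * (s - u) ^ (a - 1)) s := by
    intro s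
    by_cases h : u ≤ s
    · simp [rlKer, indicator, h, mul_comm]
    · simp [rlKer, indicator, h]
  simp_rw [e]
  rw [setIntegral_indicator measurableSet_Ici, ← rl_beta a b ha hb t u hu.2,
    intervalIntegral.integral_of_le hu.2.le, ← integral_Icc_eq_integral_Ioc]
  congr 2
  ext s
  simp only [mem_inter_iff, mem_Ioc, mem_Ici, mem_Icc]
  constructor
  · rintro ⟨⟨_, h⟩, h'⟩
    exact ⟨h', h⟩
  · rintro ⟨h, h'⟩
    exact ⟨⟨hu.1.trans_le h, h'⟩, h⟩

lemma rl_pow_int (a t : ℝ) (ha : 0 < a) :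
    IntervalIntegrable (fun u => (t - u) ^ (a - 1)) volume 0 t := by
  have := (intervalIntegral.intervalIntegrable_rpow' (a := 0) (b := t) (r := a - 1)
    (by linarith)).comp_sub_left t
  simpa using this.symm

lemma rl_sec_int (a t s : ℝ) (ha : 0 < a) (hs : s ∈ Ioc 0 t) :
    IntegrableOn (fun u => rlKer a (s - u)) (Ioc 0 t) := by
  have e : (fun u => rlKer a (s - u))
      = (Iic s).indicator (fun u => ((s - u) ^ (a - 1) : ℝ)) := by
    ext u
    by_cases h : u ≤ s
    · simp [rlKer, indicator, h]
    · simp [rlKer, indicator, h]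
  rw [e, IntegrableOn, integrable_indicator_iff measurableSet_Iic, IntegrableOn,
    Measure.restrict_restrict measurableSet_Iic, inter_comm, Ioc_inter_Iic, min_eq_right hs.2]
  exact (rl_pow_int a s ha).1

lemma rl_ker_int (a b t : ℝ) (ha : 0 < a) (hb : 0 < b) (ht : 0 < t) :
    Integrable (fun p : ℝ × ℝ => rlKer a (p.1 - p.2) * (t - p.1) ^ (b - 1))
      ((volume.restrict (Ioc 0 t)).prod (volume.restrict (Ioc 0 t))) := by
  have hm : Measurable (fun p : ℝ × ℝ => rlKer a (p.1 - p.2) * (t - p.1) ^ (b - 1)) := by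
    have := (rlKer_measurable a).comp (measurable_fst.sub measurable_snd : Measurable
      (fun p : ℝ × ℝ => p.1 - p.2))
    exact this.mul (by fun_prop)
  rw [integrable_prod_iff hm.aestronglyMeasurable]
  constructor
  · refine ae_restrict_of_forall_mem measurableSet_Ioc fun s hs => ?_
    exact (rl_sec_int a t s ha hs).mul_const ((t - s) ^ (b - 1))
  · have h1 : IntegrableOn (fun s => (s ^ a / a) * (t - s) ^ (b - 1)) (Ioc 0 t) := by
      have := (rl_pow_int b t hb).continuousOn_mul (g := fun s : ℝ => s ^ a / a)
        (((Real.continuous_rpow_const ha.le).div_const a).continuousOn)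
      exact this.1
    refine h1.congr_fun (fun s hs => ?_) measurableSet_Ioc
    have : ∀ u, ‖rlKer a (s - u) * (t - s) ^ (b - 1)‖ = rlKer a (s - u) * (t - s) ^ (b - 1) :=
      fun u => Real.norm_of_nonneg
        (mul_nonneg (rlKer_nonneg _ _) (Real.rpow_nonneg (sub_nonneg.2 hs.2) _))
    simp only [this]
    rw [integral_mul_const]
    congr 1
    have h2 := rl_inner a t s hs (fun _ => (1:ℝ))
    simp only [smul_eq_mul, mul_one] at h2
    rw [h2, intervalIntegral.integral_comp_sub_left (fun x => x ^ (a - 1)),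
      integral_rpow (Or.inl (by linarith))]
    simp [Real.zero_rpow ha.ne']

lemma rl_semigroup {X : Type*} [NormedAddCommGroup X] [NormedSpace ℝ X] [CompleteSpace X]
    (a b t : ℝ) (ha : 0 < a) (hb : 0 < b) (ht : 0 < t) (f : ℝ → X)
    (hf : ContinuousOn f (Icc 0 t)) :
    ∫ s in (0:ℝ)..t, ((t - s) ^ (b - 1) : ℝ) • ∫ u in (0:ℝ)..s, ((s - u) ^ (a - 1) : ℝ) • f u
      = ProbabilityTheory.beta a b • ∫ u in (0:ℝ)..t, ((t - u) ^ (a + b - 1) : ℝ) • f u := by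
  have hfm : AEStronglyMeasurable f (volume.restrict (Ioc 0 t)) :=
    (hf.mono Ioc_subset_Icc_self).aestronglyMeasurable measurableSet_Ioc
  obtain ⟨C, hC⟩ := isCompact_Icc.exists_bound_of_continuousOn hf
  have hb' : ∀ᵐ p : ℝ × ℝ ∂((volume.restrict (Ioc 0 t)).prod (volume.restrict (Ioc 0 t))),
      ‖f p.2‖ ≤ C := by
    rw [Measure.prod_restrict]
    exact ae_restrict_of_forall_mem (measurableSet_Ioc.prod measurableSet_Ioc)
      fun p hp => hC _ (Ioc_subset_Icc_self hp.2)
  have hI := (rl_ker_int a b t ha hb ht).smul_bdd C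
    (f := fun p : ℝ × ℝ => f p.2) hfm.comp_snd hb'
  have sw := integral_integral_swap
    (f := fun s u => (rlKer a (s - u) * (t - s) ^ (b - 1)) • f u) hI
  rw [intervalIntegral.integral_of_le ht.le, intervalIntegral.integral_of_le ht.le]
  calc _ = ∫ s in Ioc 0 t, ∫ u in Ioc 0 t, (rlKer a (s - u) * (t - s) ^ (b - 1)) • f u := by
        refine setIntegral_congr_fun measurableSet_Ioc fun s hs => ?_
        rw [← rl_inner a t s hs f, ← integral_smul]
        congr 1
        ext u
        rw [mul_comm, mul_smul]
    _ = _ := sw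
    _ = _ := by
        rw [← integral_smul, integral_Ioc_eq_integral_Ioo, integral_Ioc_eq_integral_Ioo]
        refine setIntegral_congr_fun measurableSet_Ioo fun u hu => ?_
        rw [integral_smul_const, rl_outer a b ha hb t u hu, mul_comm, mul_smul]

lemma rl_base {X : Type*} [NormedAddCommGroup X] [NormedSpace ℝ X] [CompleteSpace X]
    (T : ℝ) (hT : 0 < T) (f : ℝ → X) (hf : ContinuousOn f (Icc 0 T))
    (h0 : ∀ t ∈ Icc (0:ℝ) T, ∫ s in (0:ℝ)..t, f s = 0) :
    ∀ t ∈ Icc (0:ℝ) T, f t = 0 := by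
  intro t ht
  have : Fact (t ∈ Icc 0 T) := ⟨ht⟩
  have hi : IntervalIntegrable f volume 0 t :=
    (hf.mono (by rw [uIcc_of_le ht.1]; exact Icc_subset_Icc_right ht.2)).intervalIntegrable
  have h1 : HasDerivWithinAt (fun u => ∫ x in (0:ℝ)..u, f x) (f t) (Icc 0 T) t :=
    intervalIntegral.integral_hasDerivWithinAt_right hi
      (hf.stronglyMeasurableAtFilter_nhdsWithin measurableSet_Icc t) (hf t ht)
  have h2 : HasDerivWithinAt (fun u => ∫ x in (0:ℝ)..u, f x) 0 (Icc 0 T) t :=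
    (hasDerivWithinAt_const t (Icc 0 T) (0:X)).congr (fun x hx => h0 x hx) (h0 t ht)
  exact (uniqueDiffOn_Icc hT t ht).eq_deriv _ h1 h2

lemma rl_nat {X : Type*} [NormedAddCommGroup X] [NormedSpace ℝ X] [CompleteSpace X]
    (T : ℝ) (hT : 0 < T) (n : ℕ) : ∀ (f : ℝ → X), ContinuousOn f (Icc 0 T) →
    (∀ t ∈ Icc (0:ℝ) T, ∫ s in (0:ℝ)..t, ((t - s) ^ ((n + 1 : ℝ) - 1) : ℝ) • f s = 0) →
    ∀ t ∈ Icc (0:ℝ) T, f t = 0 := by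
  induction n with
  | zero =>
    intro f hf h0
    refine rl_base T hT f hf fun t ht => ?_
    simpa using h0 t ht
  | succ n ih =>
    intro f hf h0
    refine rl_base T hT f hf ?_
    refine ih (fun t => ∫ s in (0:ℝ)..t, f s) ?_ ?_
    · have := intervalIntegral.continuousOn_primitive_interval (a := 0) (b := T) (f := f)
        (μ := volume) (by rw [uIcc_of_le hT.le]; exact hf.integrableOn_Icc)
      rwa [uIcc_of_le hT.le] at this
    · intro t ht
      rcases ht.1.eq_or_lt with h | h
      · rw [← h]; simp
      have := rl_semigroup 1 (n + 1 : ℝ) t one_pos (by positivity) h f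
        (hf.mono (Icc_subset_Icc_right ht.2))
      have h3 := h0 t ht
      push_cast at h3
      rw [add_comm (1:ℝ), h3] at this
      simpa using this

theorem riemannLiouville_injective
    {X : Type*} [NormedAddCommGroup X] [NormedSpace ℂ X] [CompleteSpace X]
    (T : ℝ) (hT : 0 < T) (α : ℝ) (hα : 0 < α)
    (f : ℝ → X) (hf : ContinuousOn f (Icc 0 T))
    (h0 : ∀ t ∈ Icc (0:ℝ) T, RL α f t = 0) :
    ∀ t ∈ Icc (0:ℝ) T, f t = 0 := by
  have h1 : ∀ t ∈ Icc (0:ℝ) T, ∫ s in (0:ℝ)..t, ((t - s) ^ (α - 1) : ℝ) • f s = 0 := by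
    intro t ht
    have := h0 t ht
    rw [RL, smul_eq_zero] at this
    exact this.resolve_left (inv_ne_zero (Real.Gamma_pos_of_pos hα).ne')
  obtain ⟨n, hn⟩ := exists_nat_gt α
  refine rl_nat T hT n f hf fun t ht => ?_
  rcases ht.1.eq_or_lt with h | h
  · rw [← h]; simp
  have hb : 0 < (n + 1 : ℝ) - α := by linarith
  have := rl_semigroup α ((n + 1 : ℝ) - α) t hα hb h f (hf.mono (Icc_subset_Icc_right ht.2))
  rw [intervalIntegral.integral_congr (g := fun _ => (0:X))] at this
  · rw [intervalIntegral.integral_zero, eq_comm, smul_eq_zero] at this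
    have h4 := this.resolve_left (ProbabilityTheory.beta_pos hα hb).ne'
    rwa [add_sub_cancel] at h4
  · intro s hs
    rw [uIcc_of_le h.le] at hs
    beta_reduce
    rw [h1 s ⟨hs.1, hs.2.trans ht.2⟩, smul_zero]
end

section
/- Let α > 0, φ ∈ (π/2, π) and R > 0. Then for every f ∈ C([0,T];X) and every t ∈ [0,T], (1/(2πi)) ∫_{Γ(φ,R)} λ^{−α} ( ∫₀^t e^{λ(t−s)} f(s) ds ) dλ = (I^α f)(t). (This identifies the contour-integral definition of the negative fractional power B^{−α} of the time-derivative operator B, defined on {v ∈ C¹([0,T];X) : v(0)=0} by Bv = v′, with the Riemann–Liouville fractional integral.) -/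
open MeasureTheory Set Real

/-- The integral of `G` over the contour `Γ(φ,R)` running from `∞e^{−iφ}` along the ray
`{τe^{−iφ} : τ ≥ R}`, then along the arc `{Re^{iψ} : −φ ≤ ψ ≤ φ}`, then along the ray
`{τe^{iφ} : τ ≥ R}` to `∞e^{iφ}`. -/
noncomputable def contourIntegral {X : Type*} [NormedAddCommGroup X] [NormedSpace ℂ X]
    (φ R : ℝ) (G : ℂ → X) : X :=
  (∫ τ in Ioi R,
      (Complex.exp (Complex.I * φ) • G ((τ : ℂ) * Complex.exp (Complex.I * φ))
        - Complex.exp (-(Complex.I * φ)) • G ((τ : ℂ) * Complex.exp (-(Complex.I * φ)))))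
  + ∫ ψ in (-φ)..φ,
      (Complex.I * R * Complex.exp (Complex.I * ψ)) • G ((R : ℂ) * Complex.exp (Complex.I * ψ))

section HankelAux
open Filter Topology

noncomputable def gg (a u : ℝ) (w : ℂ) : ℂ := Complex.exp ((1 - a) * w + u * Complex.exp w)

noncomputable def hh (a u θ τ : ℝ) : ℂ := ((τ⁻¹ : ℝ) : ℂ) * gg a u ((Real.log τ : ℝ) + θ * Complex.I)

noncomputable def HH (a u φ R : ℝ) : ℂ :=
  (∫ τ in Ioi R, (hh a u φ τ - hh a u (-φ) τ)) +
    ∫ ψ in (-φ)..φ, Complex.I * gg a u ((Real.log R : ℝ) + ψ * Complex.I)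

lemma gg_norm (a u r θ : ℝ) (hr : 0 < r) :
    ‖gg a u ((Real.log r : ℝ) + θ * Complex.I)‖ = r ^ (1 - a) * Real.exp (u * r * Real.cos θ) := by
  rw [gg, Complex.norm_exp, Real.rpow_def_of_pos hr, ← Real.exp_add]
  congr 1
  simp only [Complex.add_re, Complex.mul_re, Complex.exp_re, Complex.exp_im, Complex.sub_re, Complex.sub_im,
    Complex.one_re, Complex.one_im, Complex.ofReal_re, Complex.ofReal_im, Complex.I_re, Complex.I_im,
    Complex.add_im, Complex.mul_im]
  simp [Real.exp_log hr]
  ring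

lemma hh_norm (a u θ r : ℝ) (hr : 0 < r) :
    ‖hh a u θ r‖ = r ^ (-a) * Real.exp (u * r * Real.cos θ) := by
  rw [hh, norm_mul, gg_norm _ _ _ _ hr, Complex.norm_real, Real.norm_of_nonneg (by positivity),
    ← mul_assoc, ← Real.rpow_neg_one, ← Real.rpow_add hr]
  ring_nf

lemma gg_diff (a u : ℝ) : Differentiable ℂ (gg a u) := by
  unfold gg; fun_prop

lemma gg_cont (a u : ℝ) : Continuous (gg a u) := (gg_diff a u).continuous

lemma hh_cont (a u θ : ℝ) : ContinuousOn (hh a u θ) (Ioi 0) := by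
  have h1 : ContinuousOn (fun τ : ℝ => τ⁻¹) (Ioi 0) := continuousOn_inv₀.mono fun x hx => ne_of_gt hx
  have h2 : ContinuousOn Real.log (Ioi 0) := Real.continuousOn_log.mono fun x hx => ne_of_gt hx
  unfold hh
  refine (Complex.continuous_ofReal.comp_continuousOn h1).mul
    ((gg_cont a u).comp_continuousOn ?_)
  exact (Complex.continuous_ofReal.comp_continuousOn h2).add continuousOn_const

lemma rect (a u r N θ₁ θ₂ : ℝ) (hr : 0 < r) (hN : 0 < N) :
    (∫ τ in r..N, hh a u θ₁ τ) - (∫ τ in r..N, hh a u θ₂ τ) +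
      Complex.I * (∫ y in θ₁..θ₂, gg a u ((Real.log N : ℝ) + y * Complex.I)) -
      Complex.I * (∫ y in θ₁..θ₂, gg a u ((Real.log r : ℝ) + y * Complex.I)) = 0 := by
  have key := Complex.integral_boundary_rect_eq_zero_of_differentiableOn (gg a u)
    (⟨Real.log r, θ₁⟩ : ℂ) (⟨Real.log N, θ₂⟩ : ℂ) (gg_diff a u).differentiableOn
  have sub : ∀ θ : ℝ, (∫ τ in r..N, hh a u θ τ) =
      ∫ x in (Real.log r)..(Real.log N), gg a u (x + θ * Complex.I) := by
    intro θ
    have hpos : ∀ x ∈ uIcc r N, 0 < x := fun x hx => lt_of_lt_of_le (lt_min hr hN) hx.1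
    have := intervalIntegral.integral_deriv_smul_comp'' (a := r) (b := N) (f := Real.log)
      (f' := fun x => x⁻¹) (g := fun x : ℝ => gg a u (x + θ * Complex.I))
      (Real.continuousOn_log.mono fun x hx => (hpos x hx).ne')
      (fun x hx => (Real.hasDerivAt_log
        (hpos x (Ioo_subset_Icc_self hx)).ne').hasDerivWithinAt)
      (continuousOn_inv₀.mono fun x hx => (hpos x hx).ne')
      (((gg_cont a u).comp (by fun_prop)).continuousOn)
    rw [← this]
    refine intervalIntegral.integral_congr fun x hx => ?_
    simp [hh, Complex.real_smul]
  rw [sub, sub]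
  simpa using key

lemma int_bound (a b R : ℝ) (ha : 0 ≤ a) (hb : 0 < b) (hR : 0 < R) :
    IntegrableOn (fun τ : ℝ => R ^ (-a) * Real.exp (-b * τ)) (Ioi R) :=
  (integrableOn_exp_mul_Ioi (by linarith) R).const_mul _

lemma hh_le (a u θ R τ : ℝ) (ha : 0 ≤ a) (hR : 0 < R) (hτ : R ≤ τ) :
    ‖hh a u θ τ‖ ≤ R ^ (-a) * Real.exp (-(-(u * Real.cos θ)) * τ) := by
  rw [hh_norm _ _ _ _ (hR.trans_le hτ)]
  have : τ ^ (-a) ≤ R ^ (-a) := Real.rpow_le_rpow_of_nonpos hR hτ (by linarith)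
  rw [show u * τ * Real.cos θ = -(-(u * Real.cos θ)) * τ by ring]
  gcongr

lemma hh_int (a u θ R : ℝ) (ha : 0 ≤ a) (hu : 0 < u) (hθ : Real.cos θ < 0) (hR : 0 < R) :
    IntegrableOn (hh a u θ) (Ioi R) := by
  refine (int_bound a (-(u * Real.cos θ)) R ha (by nlinarith) hR).mono'
    (((hh_cont a u θ).mono fun x hx => hR.trans hx).aestronglyMeasurable measurableSet_Ioi) ?_
  refine (ae_restrict_mem measurableSet_Ioi).mono fun τ hτ => hh_le a u θ R τ ha hR (le_of_lt hτ)

lemma tendsto_aux (s b : ℝ) (hb : 0 < b) :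
    Tendsto (fun N : ℝ => N ^ s * Real.exp (-b * N)) atTop (𝓝 0) :=
  tendsto_rpow_mul_exp_neg_mul_atTop_nhds_zero s b hb

lemma rect_inf (a u r θ₁ θ₂ c : ℝ) (ha : 0 ≤ a) (hu : 0 < u) (hr : 0 < r) (hc : 0 < c)
    (h : ∀ y ∈ uIcc θ₁ θ₂, Real.cos y ≤ -c) :
    (∫ τ in Ioi r, hh a u θ₁ τ) - (∫ τ in Ioi r, hh a u θ₂ τ) =
      Complex.I * (∫ y in θ₁..θ₂, gg a u ((Real.log r : ℝ) + y * Complex.I)) := by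
  have t1 := intervalIntegral_tendsto_integral_Ioi r
    (hh_int a u θ₁ r ha hu (by linarith [h _ left_mem_uIcc]) hr) tendsto_id
  have t2 := intervalIntegral_tendsto_integral_Ioi r
    (hh_int a u θ₂ r ha hu (by linarith [h _ right_mem_uIcc]) hr) tendsto_id
  have t3 : Tendsto (fun N : ℝ => ∫ y in θ₁..θ₂, gg a u ((Real.log N : ℝ) + y * Complex.I)) atTop (𝓝 0) := by
    have := (tendsto_aux (1 - a) (u * c) (by positivity)).mul_const |θ₂ - θ₁|
    rw [zero_mul] at this
    refine squeeze_zero_norm' ?_ this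
    filter_upwards [eventually_gt_atTop 0] with N hN
    refine intervalIntegral.norm_integral_le_of_norm_le_const fun y hy => ?_
    rw [gg_norm _ _ _ _ hN]
    have := h y (uIoc_subset_uIcc hy)
    have : u * N * Real.cos y ≤ -(u * c) * N := by nlinarith [mul_pos hu hN]
    gcongr
  have t4 := ((t1.sub t2).add (t3.const_mul Complex.I)).sub_const
    (Complex.I * (∫ y in θ₁..θ₂, gg a u ((Real.log r : ℝ) + y * Complex.I)))
  have t5 := tendsto_nhds_unique_of_eventuallyEq t4 (tendsto_const_nhds (x := (0:ℂ)))
    (by filter_upwards [eventually_gt_atTop 0] with N hN using rect a u r N θ₁ θ₂ hr hN)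
  rw [mul_zero, add_zero] at t5
  exact sub_eq_zero.mp t5

lemma gg_ii (a u r θ₁ θ₂ : ℝ) :
    IntervalIntegrable (fun y : ℝ => Complex.I * gg a u ((Real.log r : ℝ) + y * Complex.I)) volume θ₁ θ₂ := by
  apply Continuous.intervalIntegrable
  exact continuous_const.mul ((gg_cont a u).comp (by fun_prop))

lemma HH_eq (a u φ R : ℝ) (ha : 0 ≤ a) (hu : 0 < u) (hR : 0 < R) (hφ : Real.cos φ < 0) :
    HH a u φ R = (∫ τ in Ioi R, hh a u φ τ) - (∫ τ in Ioi R, hh a u (-φ) τ) +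
     ∫ ψ in (-φ)..φ, Complex.I * gg a u ((Real.log R : ℝ) + ψ * Complex.I) := by
  rw [HH, integral_sub (hh_int a u φ R ha hu hφ hR)
    (hh_int a u (-φ) R ha hu (by rwa [Real.cos_neg]) hR)]

lemma HH_rot (a u φ R : ℝ) (ha : 0 ≤ a) (hu : 0 < u) (hR : 0 < R) (hφ : φ ∈ Ioo (π / 2) π) :
    HH a u φ R = HH a u π R := by
  have hc : Real.cos φ < 0 := Real.cos_neg_of_pi_div_two_lt_of_lt hφ.1 (by linarith [hφ.2, pi_pos])
  have hmono : ∀ y ∈ Icc φ π, Real.cos y ≤ -(-Real.cos φ) := fun y hy => by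
    rw [neg_neg]
    exact Real.cos_le_cos_of_nonneg_of_le_pi (by linarith [hφ.1, pi_pos]) hy.2 hy.1
  rw [HH_eq a u φ R ha hu hR hc, HH_eq a u π R ha hu hR (by simp)]
  have e1 := rect_inf a u R φ π (-Real.cos φ) ha hu hR (by linarith)
    (by rw [uIcc_of_le hφ.2.le]; exact hmono)
  have e2 := rect_inf a u R (-π) (-φ) (-Real.cos φ) ha hu hR (by linarith)
    (by
      rw [uIcc_of_le (by linarith [hφ.2])]
      intro y hy
      rw [← Real.cos_neg]
      exact hmono _ ⟨by linarith [hy.2], by linarith [hy.1]⟩)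
  rw [← intervalIntegral.integral_const_mul] at e1 e2
  rw [← intervalIntegral.integral_add_adjacent_intervals (gg_ii a u R (-π) (-φ)) (gg_ii a u R (-φ) π),
    ← intervalIntegral.integral_add_adjacent_intervals (gg_ii a u R (-φ) φ) (gg_ii a u R φ π),
    ← e1, ← e2]
  ring

lemma HH_radius (a u r R : ℝ) (ha : 0 ≤ a) (hu : 0 < u) (hr : 0 < r) (hrR : r ≤ R) :
    HH a u π r = HH a u π R := by
  have hR := hr.trans_le hrR
  rw [HH_eq a u π r ha hu hr (by simp), HH_eq a u π R ha hu hR (by simp)]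
  have e := rect a u r R (-π) π hr hR
  have c1 : Real.cos π < 0 := by simp
  have c2 : Real.cos (-π) < 0 := by simp
  rw [← intervalIntegral.integral_interval_add_Ioi (hh_int a u π r ha hu c1 hr) (hh_int a u π R ha hu c1 hR),
   ← intervalIntegral.integral_interval_add_Ioi (hh_int a u (-π) r ha hu c2 hr) (hh_int a u (-π) R ha hu c2 hR),
   intervalIntegral.integral_const_mul, intervalIntegral.integral_const_mul]
  linear_combination -e

lemma HH_radius_one (a u R : ℝ) (ha : 0 ≤ a) (hu : 0 < u) (hR : 0 < R) :
    HH a u π R = HH a u π 1 := by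
  rcases le_total R 1 with h | h
  · exact HH_radius a u R 1 ha hu hR h
  · exact (HH_radius a u 1 R ha hu one_pos h).symm

lemma hh_pi (a u θ τ : ℝ) (hτ : 0 < τ) (hθ : Complex.exp (θ * Complex.I) = -1) :
    hh a u θ τ = Complex.exp ((1 - a) * (θ * Complex.I)) *
      ((τ ^ (-a) * Real.exp (-u * τ) : ℝ) : ℂ) := by
  have e : Complex.exp ((Real.log τ : ℝ) : ℂ) = τ := by
    rw [← Complex.ofReal_exp, Real.exp_log hτ]
  have e2 : ((τ⁻¹ : ℝ) : ℂ) = Complex.exp (-((Real.log τ : ℝ) : ℂ)) := by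
    rw [Complex.exp_neg, e]; simp
  rw [hh, gg, Complex.exp_add ((Real.log τ : ℝ) : ℂ), e, hθ, e2, Real.rpow_def_of_pos hτ]
  push_cast
  rw [← Complex.exp_add, ← Complex.exp_add, ← Complex.exp_add]
  congr 1
  ring

lemma exp_pi' : Complex.exp (((-π : ℝ) : ℂ) * Complex.I) = -1 := by
  push_cast
  rw [neg_mul, Complex.exp_neg, Complex.exp_pi_mul_I]; norm_num

lemma base_int (a u : ℝ) (ha1 : a < 1) (hu : 0 < u) :
    IntegrableOn (fun τ : ℝ => τ ^ (-a) * Real.exp (-u * τ)) (Ioi 0) := by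
  simpa using integrableOn_rpow_mul_exp_neg_mul_rpow (p := 1) (s := -a) (b := u)
    (by linarith) one_pos hu

lemma hh_int0 (a u θ : ℝ) (ha1 : a < 1) (hu : 0 < u)
    (hθ : Complex.exp (θ * Complex.I) = -1) : IntegrableOn (hh a u θ) (Ioi 0) := by
  have := ((base_int a u ha1 hu).ofReal (𝕜 := ℂ)).const_mul (Complex.exp ((1 - a) * (θ * Complex.I)))
  exact IntegrableOn.congr_fun this (fun τ hτ => (hh_pi a u θ τ hτ hθ).symm) measurableSet_Ioi

lemma hh_val0 (a u θ : ℝ) (ha1 : a < 1) (hu : 0 < u)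
    (hθ : Complex.exp (θ * Complex.I) = -1) : ∫ τ in Ioi 0, hh a u θ τ =
      Complex.exp ((1 - a) * (θ * Complex.I)) * (((1 / u) ^ (1 - a) * Real.Gamma (1 - a) : ℝ) : ℂ) := by
  rw [setIntegral_congr_fun measurableSet_Ioi (fun τ hτ => hh_pi a u θ τ hτ hθ),
    integral_const_mul, ← Real.integral_rpow_mul_exp_neg_mul_Ioi (by linarith) hu]
  congr 1
  refine (integral_ofReal (𝕜 := ℂ) (f := fun τ : ℝ => τ ^ (-a) * Real.exp (-u * τ))).trans ?_
  congr 1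
  refine setIntegral_congr_fun measurableSet_Ioi fun τ _ => ?_
  congr 2 <;> ring

lemma HH_base (a u R : ℝ) (ha : 0 < a) (ha1 : a < 1) (hu : 0 < u) (hR : 0 < R) :
    HH a u π R = 2 * π * Complex.I * ((u ^ (a - 1) / Real.Gamma a : ℝ) : ℂ) := by
  have hp : Complex.exp ((π : ℂ) * Complex.I) = -1 := Complex.exp_pi_mul_I
  have i1 := hh_int0 a u π ha1 hu hp
  have i2 := hh_int0 a u (-π) ha1 hu exp_pi'
  have lim : Tendsto (fun r => HH a u π r) (𝓝[>] 0)
      (𝓝 ((∫ τ in Ioi 0, hh a u π τ) - (∫ τ in Ioi 0, hh a u (-π) τ) + 0)) := by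
    have tray : ∀ θ : ℝ, IntegrableOn (hh a u θ) (Ioi 0) →
        Tendsto (fun r : ℝ => ∫ τ in Ioi r, hh a u θ τ) (𝓝[>] 0) (𝓝 (∫ τ in Ioi 0, hh a u θ τ)) := by
      intro θ hi
      have c := intervalIntegral.continuousOn_primitive_interval (f := hh a u θ) (a := 0) (b := 1)
        (μ := volume) (by
          rw [uIcc_of_le zero_le_one, integrableOn_Icc_iff_integrableOn_Ioc]
          exact hi.mono_set Ioc_subset_Ioi_self)
      have c0 := c 0 left_mem_uIcc
      have c1 : Tendsto (fun x => ∫ t in (0:ℝ)..x, hh a u θ t) (𝓝[>] 0) (𝓝 0) := by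
        have := c0.tendsto
        rw [intervalIntegral.integral_same] at this
        refine this.mono_left ?_
        rw [uIcc_of_le zero_le_one]
        rw [nhdsWithin_Icc_eq_nhdsGE zero_lt_one]
        exact nhdsWithin_mono _ Ioi_subset_Ici_self
      have c2 := (tendsto_const_nhds (x := ∫ τ in Ioi 0, hh a u θ τ)).sub c1
      rw [sub_zero] at c2
      refine c2.congr' ?_
      filter_upwards [self_mem_nhdsWithin] with r hr
      rw [← intervalIntegral.integral_interval_add_Ioi hi
        (hi.mono_set (Ioi_subset_Ioi (le_of_lt hr)))]
      ring
    have tarc : Tendsto (fun r : ℝ => ∫ ψ in (-π)..π, Complex.I * gg a u ((Real.log r : ℝ) + ψ * Complex.I))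
        (𝓝[>] 0) (𝓝 0) := by
      have b : Tendsto (fun r : ℝ => r ^ (1 - a) * Real.exp (u * r) * |π - -π|) (𝓝[>] 0) (𝓝 0) := by
        have : ContinuousAt (fun r : ℝ => r ^ (1 - a) * Real.exp (u * r) * |π - -π|) 0 := by
          refine ContinuousAt.mul (ContinuousAt.mul ?_ (by fun_prop)) continuousAt_const
          exact Real.continuousAt_rpow_const _ _ (Or.inr (by linarith))
        have t := this.tendsto
        simp only [Real.zero_rpow (by linarith : (1 - a) ≠ 0), zero_mul] at t
        exact t.mono_left nhdsWithin_le_nhds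
      refine squeeze_zero_norm' ?_ b
      filter_upwards [self_mem_nhdsWithin] with r hr
      have hr : 0 < r := hr
      refine intervalIntegral.norm_integral_le_of_norm_le_const fun y hy => ?_
      rw [norm_mul, Complex.norm_I, one_mul, gg_norm _ _ _ _ hr]
      have : u * r * Real.cos y ≤ u * r := by nlinarith [mul_pos hu hr, Real.cos_le_one y]
      gcongr
    refine (((tray π i1).sub (tray (-π) i2)).add tarc).congr' ?_
    filter_upwards [self_mem_nhdsWithin] with r hr
    rw [HH_eq a u π r ha.le hu hr (by simp)]
  have lim2 : Tendsto (fun r => HH a u π r) (𝓝[>] 0) (𝓝 (HH a u π R)) := by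
    refine tendsto_const_nhds.congr' ?_
    filter_upwards [self_mem_nhdsWithin] with r hr
    rw [HH_radius_one a u R ha.le hu hR, HH_radius_one a u r ha.le hu hr]
  rw [tendsto_nhds_unique lim2 lim, hh_val0 a u π ha1 hu hp, hh_val0 a u (-π) ha1 hu exp_pi',
    add_zero, ← sub_mul]
  have s : Complex.exp ((1 - a) * ((π : ℂ) * Complex.I)) - Complex.exp ((1 - a) * (((-π : ℝ) : ℂ) * Complex.I))
      = 2 * Complex.I * ((Real.sin (π * a) : ℝ) : ℂ) := by
    have : Real.sin (π * a) = Real.sin (π * (1 - a)) := by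
      rw [← Real.sin_pi_sub]; ring_nf
    rw [this]
    push_cast
    rw [Complex.sin]
    have e1 : Complex.exp ((1 - a) * ((π : ℂ) * Complex.I)) = Complex.exp (π * (1 - a) * Complex.I) := by
      congr 1; ring
    have e2 : Complex.exp ((1 - a) * (-(π : ℂ) * Complex.I)) = Complex.exp (-(π * (1 - a)) * Complex.I) := by
      congr 1; ring
    rw [e1, e2]
    linear_combination (Complex.exp (π * (1 - a) * Complex.I) - Complex.exp (-(π * (1 - a)) * Complex.I)) * Complex.I_sq
  rw [s]
  have hs : 0 < Real.sin (π * a) := Real.sin_pos_of_pos_of_lt_pi (by positivity) (by nlinarith [pi_pos])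
  have hG := Real.Gamma_mul_Gamma_one_sub a
  have hGa := Real.Gamma_pos_of_pos ha
  have fin : Real.sin (π * a) * ((1 / u) ^ (1 - a) * Real.Gamma (1 - a)) = π * (u ^ (a - 1) / Real.Gamma a) := by
    have : (1 / u) ^ (1 - a) = u ^ (a - 1) := by
      rw [one_div, Real.inv_rpow hu.le, ← Real.rpow_neg hu.le]; ring_nf
    rw [this]
    rw [eq_div_iff hs.ne'] at hG
    field_simp
    linear_combination hG
  have fin' := congrArg (fun x : ℝ => (x : ℂ)) fin
  push_cast at fin' ⊢
  linear_combination 2 * Complex.I * fin'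

lemma gg_deriv (a u : ℝ) (w : ℂ) :
    HasDerivAt (gg (a + 1) u) (-a * gg (a + 1) u w + u * gg a u w) w := by
  have h : HasDerivAt (fun w : ℂ => (1 - ((a + 1 : ℝ) : ℂ)) * w + u * Complex.exp w)
      ((1 - ((a + 1 : ℝ) : ℂ)) * 1 + u * Complex.exp w) w :=
    ((hasDerivAt_id w).const_mul _).add ((Complex.hasDerivAt_exp w).const_mul _)
  have := h.cexp
  unfold gg
  refine this.congr_deriv ?_
  have : Complex.exp ((1 - a) * w + u * Complex.exp w) =
    Complex.exp ((1 - ((a + 1 : ℝ) : ℂ)) * w + u * Complex.exp w) * Complex.exp w := by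
    rw [← Complex.exp_add]; congr 1; push_cast; ring
  rw [this]
  push_cast
  ring

lemma HH_rec (a u R : ℝ) (ha : 0 ≤ a) (hu : 0 < u) (hR : 0 < R) :
    a * HH (a + 1) u π R = u * HH a u π R := by
  have ray : ∀ θ : ℝ, Real.cos θ < 0 → -a * (∫ τ in Ioi R, hh (a + 1) u θ τ) + u * (∫ τ in Ioi R, hh a u θ τ)
      = - gg (a + 1) u ((Real.log R : ℝ) + θ * Complex.I) := by
    intro θ hθ
    have i1 := (hh_int (a + 1) u θ R (by linarith) hu hθ hR).const_mul (-a : ℂ)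
    have i2 := (hh_int a u θ R (by linarith) hu hθ hR).const_mul (u : ℂ)
    have := integral_Ioi_of_hasDerivAt_of_tendsto'
      (f := fun τ : ℝ => gg (a + 1) u ((Real.log τ : ℝ) + θ * Complex.I))
      (f' := fun τ => -a * hh (a + 1) u θ τ + u * hh a u θ τ) (a := R) (m := 0)
      (by
        intro τ hτ
        have hτ : 0 < τ := hR.trans_le hτ
        have d1 := ((Real.hasDerivAt_log hτ.ne').ofReal_comp).add_const (θ * Complex.I)
        have := (gg_deriv a u ((Real.log τ : ℝ) + θ * Complex.I)).comp τ d1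
        refine this.congr_deriv ?_
        unfold hh
        ring)
      (i1.add i2)
      (by
        have t := tendsto_aux (1 - (a + 1)) (-(u * Real.cos θ)) (by nlinarith)
        refine squeeze_zero_norm' ?_ t
        filter_upwards [eventually_gt_atTop 0] with N hN
        rw [gg_norm _ _ _ _ hN]
        apply le_of_eq
        ring_nf)
    rw [integral_add i1 i2, integral_const_mul, integral_const_mul, zero_sub] at this
    exact this
  have arc : -a * (∫ ψ in (-π)..π, Complex.I * gg (a + 1) u ((Real.log R : ℝ) + ψ * Complex.I)) +
      u * (∫ ψ in (-π)..π, Complex.I * gg a u ((Real.log R : ℝ) + ψ * Complex.I)) =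
      gg (a + 1) u ((Real.log R : ℝ) + (π : ℝ) * Complex.I) -
      gg (a + 1) u ((Real.log R : ℝ) + (-π : ℝ) * Complex.I) := by
    have i1 := (gg_ii (a + 1) u R (-π) π).const_mul (-a : ℂ)
    have i2 := (gg_ii a u R (-π) π).const_mul (u : ℂ)
    have := intervalIntegral.integral_eq_sub_of_hasDerivAt (a := -π) (b := π)
      (f := fun ψ : ℝ => gg (a + 1) u ((Real.log R : ℝ) + ψ * Complex.I))
      (f' := fun ψ : ℝ => -a * (Complex.I * gg (a + 1) u ((Real.log R : ℝ) + ψ * Complex.I)) +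
        u * (Complex.I * gg a u ((Real.log R : ℝ) + ψ * Complex.I)))
      (by
        intro ψ _
        have d1 := (((hasDerivAt_id ψ).ofReal_comp).mul_const Complex.I).const_add ((Real.log R : ℝ) : ℂ)
        have := (gg_deriv a u ((Real.log R : ℝ) + ψ * Complex.I)).comp ψ d1
        refine this.congr_deriv ?_
        push_cast
        ring)
      (i1.add i2)
    rw [intervalIntegral.integral_add i1 i2, intervalIntegral.integral_const_mul (-a : ℂ),
      intervalIntegral.integral_const_mul (u : ℂ)] at this
    exact this
  rw [HH_eq (a + 1) u π R (by linarith) hu hR (by simp), HH_eq a u π R ha hu hR (by simp)]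
  have r1 := ray π (by simp)
  have r2 := ray (-π) (by simp)
  linear_combination r2 - r1 - arc

lemma HH_cont_one (u : ℝ) (hu : 0 < u) :
    Tendsto (fun a => HH a u π 1) (𝓝[<] 1) (𝓝 (HH 1 u π 1)) := by
  have hcont : Continuous (fun p : ℝ × ℝ => Complex.I * gg p.1 u ((Real.log 1 : ℝ) + p.2 * Complex.I)) := by
    unfold gg; fun_prop
  have arc : Tendsto (fun a : ℝ => ∫ ψ in (-π)..π, Complex.I * gg a u ((Real.log 1 : ℝ) + ψ * Complex.I))
      (𝓝[<] 1) (𝓝 (∫ ψ in (-π)..π, Complex.I * gg (1 : ℝ) u ((Real.log 1 : ℝ) + ψ * Complex.I))) :=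
    ((intervalIntegral.continuous_parametric_intervalIntegral_of_continuous'
      (f := fun a ψ : ℝ => Complex.I * gg a u ((Real.log 1 : ℝ) + ψ * Complex.I)) hcont (-π) π).tendsto
        1).mono_left nhdsWithin_le_nhds
  refine Tendsto.add ?_ arc
  refine tendsto_integral_filter_of_dominated_convergence (fun τ => 2 * Real.exp (-u * τ)) ?_ ?_ ?_ ?_
  · refine Eventually.of_forall fun a => ?_
    refine ContinuousOn.aestronglyMeasurable ?_ measurableSet_Ioi
    exact ((hh_cont a u π).sub (hh_cont a u (-π))).mono (Ioi_subset_Ioi zero_le_one)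
  · have : ∀ᶠ a : ℝ in 𝓝[<] 1, 0 < a := by
      filter_upwards [mem_nhdsWithin_of_mem_nhds (lt_mem_nhds (zero_lt_one' ℝ))] with a ha using ha
    filter_upwards [this] with a ha
    refine (ae_restrict_mem measurableSet_Ioi).mono fun τ hτ => ?_
    have h1 := hh_le a u π 1 τ ha.le one_pos (le_of_lt hτ)
    have h2 := hh_le a u (-π) 1 τ ha.le one_pos (le_of_lt hτ)
    simp at h1 h2
    refine (norm_sub_le _ _).trans ?_
    rw [neg_mul]
    linarith
  · exact (integrableOn_exp_mul_Ioi (by linarith) 1).const_mul _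
  · refine Eventually.of_forall fun τ => ?_
    have : Continuous (fun a => hh a u π τ - hh a u (-π) τ) := by
      unfold hh gg; fun_prop
    exact (this.tendsto 1).mono_left nhdsWithin_le_nhds

lemma HH_one (u R : ℝ) (hu : 0 < u) (hR : 0 < R) :
    HH 1 u π R = 2 * π * Complex.I * ((u ^ ((1:ℝ) - 1) / Real.Gamma 1 : ℝ) : ℂ) := by
  rw [HH_radius_one 1 u R zero_le_one hu hR]
  have c : ContinuousAt (fun a : ℝ => u ^ (a - 1) / Real.Gamma a) 1 := by
    refine ContinuousAt.div ?_ ?_ (by simp)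
    · exact ContinuousAt.rpow continuousAt_const (by fun_prop) (Or.inl hu.ne')
    · refine (Real.differentiableAt_Gamma fun m => ?_).continuousAt
      have : (0:ℝ) ≤ m := Nat.cast_nonneg m
      linarith
  have c2 : Tendsto (fun a : ℝ => 2 * π * Complex.I * ((u ^ (a - 1) / Real.Gamma a : ℝ) : ℂ)) (𝓝[<] 1)
     (𝓝 (2 * π * Complex.I * ((u ^ ((1:ℝ) - 1) / Real.Gamma 1 : ℝ) : ℂ))) :=
    (((Complex.continuous_ofReal.tendsto _).comp c.tendsto).const_mul _).mono_left nhdsWithin_le_nhds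
  refine tendsto_nhds_unique_of_eventuallyEq (HH_cont_one u hu) c2 ?_
  filter_upwards [mem_nhdsWithin_of_mem_nhds (lt_mem_nhds (zero_lt_one' ℝ)), self_mem_nhdsWithin]
    with a ha ha1
  exact HH_base a u 1 ha ha1 hu one_pos

lemma HH_all (n : ℕ) : ∀ (a u R : ℝ), 0 < a → a ≤ n + 1 → 0 < u → 0 < R →
    HH a u π R = 2 * π * Complex.I * ((u ^ (a - 1) / Real.Gamma a : ℝ) : ℂ) := by
  induction n with
  | zero =>
    intro a u R ha ha1 hu hR
    simp at ha1
    rcases ha1.lt_or_eq with h | rfl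
    · exact HH_base a u R ha h hu hR
    · exact HH_one u R hu hR
  | succ n ih =>
    intro a u R ha ha1 hu hR
    push_cast at ha1
    rcases le_or_gt a 1 with h | h
    · exact ih a u R ha (by have : (0:ℝ) ≤ n := Nat.cast_nonneg n
                            linarith) hu hR
    · have i := ih (a - 1) u R (by linarith) (by linarith) hu hR
      have r := HH_rec (a - 1) u R (by linarith) hu hR
      rw [sub_add_cancel, i] at r
      have hne : ((a - 1 : ℝ) : ℂ) ≠ 0 := by
        rw [Ne, Complex.ofReal_eq_zero]; linarith
      apply mul_left_cancel₀ hne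
      rw [r]
      have hG : Real.Gamma a = (a - 1) * Real.Gamma (a - 1) := by
        conv_lhs => rw [← sub_add_cancel a 1]
        exact Real.Gamma_add_one (by linarith)
      have hGp := Real.Gamma_pos_of_pos (by linarith : 0 < a - 1)
      have hu1 : u ^ (a - 1) = u * u ^ (a - 1 - 1) := by
        rw [Real.rpow_sub_one hu.ne' (a - 1)]; field_simp
      have : (a - 1) * (u ^ (a - 1) / Real.Gamma a) = u * (u ^ (a - 1 - 1) / Real.Gamma (a - 1)) := by
        rw [hG, hu1]
        have : a - 1 ≠ 0 := by linarith
        field_simp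
      have t := congrArg (fun x : ℝ => (x : ℂ)) this
      simp only [Complex.ofReal_mul] at t ⊢
      linear_combination -(2 * π * Complex.I) * t

lemma hankel (a u φ R : ℝ) (ha : 0 < a) (hu : 0 < u) (hR : 0 < R) (hφ : φ ∈ Ioo (π / 2) π) :
    HH a u φ R = 2 * π * Complex.I * ((u ^ (a - 1) / Real.Gamma a : ℝ) : ℂ) := by
  rw [HH_rot a u φ R ha.le hu hR hφ]
  obtain ⟨n, hn⟩ := exists_nat_ge a
  exact HH_all n a u R ha (by linarith) hu hR

lemma cp (a u θ τ : ℝ) (hτ : 0 < τ) (h1 : -π < θ) (h2 : θ ≤ π) :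
    Complex.exp (Complex.I * θ) * ((τ * Complex.exp (Complex.I * θ)) ^ (-(a : ℂ)) *
      Complex.exp (τ * Complex.exp (Complex.I * θ) * u)) = hh a u θ τ := by
  have e : Complex.exp ((Real.log τ : ℝ) : ℂ) = τ := by
    rw [← Complex.ofReal_exp, Real.exp_log hτ]
  have e2 : ((τ⁻¹ : ℝ) : ℂ) = Complex.exp (-((Real.log τ : ℝ) : ℂ)) := by
    rw [Complex.exp_neg, e]; simp
  have e3 : τ * Complex.exp (Complex.I * θ) = Complex.exp ((Real.log τ : ℝ) + θ * Complex.I) := by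
    rw [Complex.exp_add, e, mul_comm Complex.I]
  have e4 : (τ * Complex.exp (Complex.I * θ)) ^ (-(a : ℂ)) =
      Complex.exp (((Real.log τ : ℝ) + θ * Complex.I) * (-(a : ℂ))) := by
    rw [e3, Complex.cpow_def_of_ne_zero (Complex.exp_ne_zero _), Complex.log_exp (by simpa using h1)
      (by simpa using h2)]
  rw [e4, e3, hh, gg, e2, ← Complex.exp_add, ← Complex.exp_add, ← Complex.exp_add]
  congr 1
  ring

lemma exp_le_rpow (x p : ℝ) (hx : 0 < x) (hp : 0 < p) (hp1 : p < 1) :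
    Real.exp (-x) ≤ x ^ (-p) := by
  rw [Real.exp_neg, Real.rpow_neg hx.le]
  gcongr
  calc x ^ p ≤ (1 + x) ^ p := by gcongr; linarith
    _ ≤ (1 + x) ^ (1 : ℝ) := Real.rpow_le_rpow_of_exponent_le (by linarith) hp1.le
    _ = x + 1 := by rw [Real.rpow_one]; ring
    _ ≤ Real.exp x := Real.add_one_le_exp x

lemma hh_le2 (a u θ τ p c : ℝ) (hτ : 0 < τ) (hu : 0 < u) (hc : 0 < c) (hθ : Real.cos θ = -c)
    (hp : 0 < p) (hp1 : p < 1) :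
    ‖hh a u θ τ‖ ≤ c ^ (-p) * τ ^ (-a - p) * u ^ (-p) := by
  rw [hh_norm _ _ _ _ hτ, hθ]
  have := exp_le_rpow (c * τ * u) p (by positivity) hp hp1
  rw [Real.mul_rpow (by positivity) hu.le, Real.mul_rpow hc.le hτ.le] at this
  rw [show u * τ * -c = -(c * τ * u) by ring, sub_eq_add_neg, Real.rpow_add hτ]
  calc _ ≤ τ ^ (-a) * (c ^ (-p) * τ ^ (-p) * u ^ (-p)) := by gcongr
    _ = _ := by ring

lemma fub1 {X : Type*} [NormedAddCommGroup X] [NormedSpace ℂ X]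
    (a φ R t M : ℝ) (ha : 0 < a) (hR : 0 < R) (ht : 0 ≤ t) (hφ : Real.cos φ < 0)
    (F : ℝ → X) (hF : Continuous F) (hM : ∀ x, ‖F x‖ ≤ M) :
    Integrable (Function.uncurry fun τ s : ℝ => (hh a (t - s) φ τ - hh a (t - s) (-φ) τ) • F s)
      ((volume.restrict (Ioi R)).prod (volume.restrict (Ioo 0 t))) := by
  have hM0 : 0 ≤ M := (norm_nonneg _).trans (hM 0)
  obtain ⟨p, hp, hp1, hap⟩ : ∃ p : ℝ, 0 < p ∧ p < 1 ∧ 1 < a + p := by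
    rcases le_or_gt a 1 with h | h
    · exact ⟨1 - a / 2, by linarith, by linarith, by linarith⟩
    · exact ⟨1 / 2, by norm_num, by norm_num, by linarith⟩
  have i1 : Integrable (fun τ : ℝ => (2 * M * (-Real.cos φ) ^ (-p)) * τ ^ (-a - p)) (volume.restrict (Ioi R)) :=
    (integrableOn_Ioi_rpow_of_lt (by linarith) hR).const_mul _
  have i2 : Integrable (fun s : ℝ => (t - s) ^ (-p)) (volume.restrict (Ioo 0 t)) := by
    have h := (intervalIntegral.intervalIntegrable_rpow' (a := 0) (b := t) (r := -p) (by linarith)).comp_sub_left t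
    simp only [sub_zero, sub_self] at h
    have := (intervalIntegrable_iff_integrableOn_Ioc_of_le ht).mp h.symm
    exact this.mono_set Ioo_subset_Ioc_self
  refine (i1.mul_prod i2).mono' ?_ ?_
  · have m : Measurable (fun q : ℝ × ℝ => hh a (t - q.2) φ q.1 - hh a (t - q.2) (-φ) q.1) := by
      unfold hh gg; fun_prop
    exact (m.stronglyMeasurable.smul
      (hF.stronglyMeasurable.comp_measurable measurable_snd)).aestronglyMeasurable
  · rw [Measure.prod_restrict]
    refine (ae_restrict_mem (measurableSet_Ioi.prod measurableSet_Ioo)).mono ?_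
    rintro ⟨τ, s⟩ ⟨h1, h2⟩
    have hτ : 0 < τ := hR.trans h1
    have hs : 0 < t - s := by have := h2.2; simp at this; linarith
    have b1 := hh_le2 a (t - s) φ τ p (-Real.cos φ) hτ hs (by linarith) (by ring) hp hp1
    have b2 := hh_le2 a (t - s) (-φ) τ p (-Real.cos φ) hτ hs (by linarith) (by rw [Real.cos_neg]; ring) hp hp1
    simp only [Function.uncurry]
    rw [norm_smul]
    have b3 := (norm_sub_le (hh a (t - s) φ τ) (hh a (t - s) (-φ) τ)).trans (add_le_add b1 b2)
    refine (mul_le_mul b3 (hM s) (norm_nonneg _) ((norm_nonneg _).trans b3)).trans (le_of_eq ?_)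
    ring

lemma fub2 {X : Type*} [NormedAddCommGroup X] [NormedSpace ℂ X]
    (a φ R t : ℝ) (F : ℝ → X) (hF : Continuous F) :
    Integrable (Function.uncurry fun ψ s : ℝ => (Complex.I * gg a (t - s) ((Real.log R : ℝ) + ψ * Complex.I)) • F s)
      ((volume.restrict (Ioc (-φ) φ)).prod (volume.restrict (Ioo 0 t))) := by
  rw [Measure.prod_restrict]
  have c : Continuous (Function.uncurry fun ψ s : ℝ => (Complex.I * gg a (t - s) ((Real.log R : ℝ) + ψ * Complex.I)) • F s) := by
    unfold gg Function.uncurry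
    fun_prop
  have : IntegrableOn (Function.uncurry fun ψ s : ℝ => (Complex.I * gg a (t - s) ((Real.log R : ℝ) + ψ * Complex.I)) • F s)
      (Icc (-φ) φ ×ˢ Icc 0 t) (volume.prod volume) :=
    c.continuousOn.integrableOn_compact (isCompact_Icc.prod isCompact_Icc)
  exact this.mono_set (prod_mono Ioc_subset_Icc_self Ioo_subset_Icc_self)

lemma main_cont {X : Type*} [NormedAddCommGroup X] [NormedSpace ℂ X] [CompleteSpace X]
    (α : ℝ) (hα : 0 < α)
    (φ : ℝ) (hφ : φ ∈ Ioo (π / 2) π) (R : ℝ) (hR : 0 < R)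
    (F : ℝ → X) (hF : Continuous F) (M : ℝ) (hM : ∀ x, ‖F x‖ ≤ M) (t : ℝ) (ht : 0 ≤ t) :
    (2 * π * Complex.I)⁻¹ •
        contourIntegral φ R
          (fun l => (l ^ (-(α : ℂ))) • ∫ s in (0:ℝ)..t, Complex.exp (l * (t - s)) • F s)
      = RL α F t := by
  have hc : Real.cos φ < 0 := Real.cos_neg_of_pi_div_two_lt_of_lt hφ.1 (by linarith [hφ.2, pi_pos])
  have hφ0 : 0 < φ := by linarith [hφ.1, pi_pos]
  have G : ∀ τ θ : ℝ, 0 < τ → -π < θ → θ ≤ π →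
      Complex.exp (Complex.I * θ) • (((τ * Complex.exp (Complex.I * θ)) ^ (-(α : ℂ))) •
        ∫ s in (0:ℝ)..t, Complex.exp (τ * Complex.exp (Complex.I * θ) * (t - s)) • F s) =
      ∫ s in Ioo 0 t, hh α (t - s) θ τ • F s := by
    intro τ θ hτ h1 h2
    rw [intervalIntegral.integral_of_le ht, integral_Ioc_eq_integral_Ioo, ← integral_smul, ← integral_smul]
    refine integral_congr_ae (Eventually.of_forall fun s => ?_)
    simp only
    rw [← cp α (t - s) θ τ hτ h1 h2, smul_smul, smul_smul]
    push_cast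
    ring_nf
  have hi : ∀ τ θ : ℝ, IntegrableOn (fun s => hh α (t - s) θ τ • F s) (Ioo 0 t) := by
    intro τ θ
    have : Continuous (fun s => hh α (t - s) θ τ • F s) := by unfold hh gg; fun_prop
    exact (this.continuousOn.integrableOn_compact isCompact_Icc).mono_set Ioo_subset_Icc_self
  have e1 : contourIntegral φ R
          (fun l => (l ^ (-(α : ℂ))) • ∫ s in (0:ℝ)..t, Complex.exp (l * (t - s)) • F s) =
      (∫ τ in Ioi R, ∫ s in Ioo 0 t, (hh α (t - s) φ τ - hh α (t - s) (-φ) τ) • F s) +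
      ∫ ψ in Ioc (-φ) φ, ∫ s in Ioo 0 t, (Complex.I * gg α (t - s) ((Real.log R : ℝ) + ψ * Complex.I)) • F s := by
    unfold contourIntegral
    congr 1
    · refine setIntegral_congr_fun measurableSet_Ioi fun τ hτ => ?_
      have hτ : 0 < τ := hR.trans hτ
      simp only [sub_smul]
      rw [integral_sub (hi τ φ) (hi τ (-φ)), ← G τ φ hτ (by linarith [pi_pos]) hφ.2.le,
        ← G τ (-φ) hτ (by linarith [hφ.2]) (by linarith [pi_pos])]
      push_cast
      simp only [mul_neg]
    · rw [intervalIntegral.integral_of_le (by linarith)]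
      refine setIntegral_congr_fun measurableSet_Ioc fun ψ hψ => ?_
      have g1 := G R ψ hR (by linarith [hψ.1, hφ.2]) (by linarith [hψ.2, hφ.2])
      simp only
      rw [mul_smul, g1, ← integral_smul]
      refine integral_congr_ae (Eventually.of_forall fun s => ?_)
      simp only [hh]
      rw [smul_smul]
      have : (R : ℂ) ≠ 0 := by exact_mod_cast hR.ne'
      congr 1
      push_cast
      field_simp
  have f1 := fub1 α φ R t M hα hR ht hc F hF hM
  have f2 := fub2 α φ R t F hF
  have j1 := f1.integral_prod_right
  have j2 := f2.integral_prod_right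
  simp only [Function.uncurry] at j1 j2
  rw [e1, integral_integral_swap f1, integral_integral_swap f2,
    ← integral_add j1 j2, RL,
    intervalIntegral.integral_of_le ht, integral_Ioc_eq_integral_Ioo, ← integral_smul, ← integral_smul]
  refine setIntegral_congr_fun measurableSet_Ioo fun s hs => ?_
  have hs' : 0 < t - s := by linarith [hs.2]
  have k := hankel α (t - s) φ R hα hs' hR hφ
  rw [HH, intervalIntegral.integral_of_le (by linarith)] at k
  rw [integral_smul_const, integral_smul_const, ← add_smul, k, smul_smul, smul_smul, ← mul_assoc,
    inv_mul_cancel₀ Complex.two_pi_I_ne_zero, one_mul, Complex.coe_smul]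
  congr 1
  ring

end HankelAux

/-- The contour-integral definition of the negative fractional power `B^{−α}` of the
time-derivative operator `B` (with domain `{v ∈ C¹([0,T];X) : v(0)=0}`, `Bv = v′`)
coincides with the Riemann–Liouville fractional integral:
`(1/(2πi)) ∫_{Γ(φ,R)} λ^{−α} (∫₀^t e^{λ(t−s)} f(s) ds) dλ = (I^α f)(t)`. -/
theorem negative_fractional_power_eq_riemannLiouville
    {X : Type*} [NormedAddCommGroup X] [NormedSpace ℂ X] [CompleteSpace X]
    (T : ℝ) (hT : 0 < T) (α : ℝ) (hα : 0 < α)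
    (φ : ℝ) (hφ : φ ∈ Ioo (π / 2) π) (R : ℝ) (hR : 0 < R)
    (f : ℝ → X) (hf : ContinuousOn f (Icc 0 T)) :
    ∀ t ∈ Icc (0:ℝ) T,
      (2 * π * Complex.I)⁻¹ •
        contourIntegral φ R
          (fun l => (l ^ (-(α : ℂ))) • ∫ s in (0:ℝ)..t, Complex.exp (l * (t - s)) • f s)
      = RL α f t := by
  intro t ht
  let F : ℝ → X := IccExtend hT.le ((Icc 0 T).restrict f)
  have hF : Continuous F := hf.restrict.Icc_extend'
  obtain ⟨M, hM⟩ := isCompact_Icc.exists_bound_of_continuousOn hf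
  have hFM : ∀ x, ‖F x‖ ≤ M := fun x => hM _ (projIcc 0 T hT.le x).2
  have hFf : ∀ s ∈ uIcc 0 t, f s = F s := by
    intro s hs
    rw [uIcc_of_le ht.1] at hs
    exact (IccExtend_of_mem hT.le ((Icc 0 T).restrict f) ⟨hs.1, hs.2.trans ht.2⟩).symm
  have key := main_cont α hα φ hφ R hR F hF M hFM t ht.1
  have e1 : ∀ l : ℂ, (∫ s in (0:ℝ)..t, Complex.exp (l * (t - s)) • f s) =
      ∫ s in (0:ℝ)..t, Complex.exp (l * (t - s)) • F s := fun l =>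
    intervalIntegral.integral_congr fun s hs => by simp only [hFf s hs]
  have e2 : RL α f t = RL α F t := by
    unfold RL
    congr 1
    exact intervalIntegral.integral_congr fun s hs => by simp only [hFf s hs]
  simp only [e1, e2]
  exact key
end

section
/- Let α ∈ (1,2). Let f ∈ C([0,T];X) and suppose there is a bounded function g : [0,T] → X₁ with f(t) = j(g(t)) for all t, with K := sup_{t∈[0,T]} ‖g(t)‖_{X₁}. Then u := I^α f belongs to C¹([0,T];X), u(0) = u′(0) = 0, u′(t) = (I^{α−1} f)(t) for all t ∈ [0,T], and there exists v : [0,T] → X₁ with j(v(t)) = u′(t) for all t and ‖v(t) − v(s)‖_{X₁} ≤ (2/Γ(α)) |t−s|^{α−1} K for all s, t ∈ [0,T]. -/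
open MeasureTheory Set Real

theorem aux_smul_integrable {X : Type*} [NormedAddCommGroup X] [NormedSpace ℂ X]
    {f : ℝ → X} {T : ℝ} (hf : ContinuousOn f (Icc 0 T)) {a b : ℝ} (ha : 0 ≤ a) (hab : a ≤ b)
    (hb : b ≤ T) {h : ℝ → ℝ} (hh : IntervalIntegrable h volume a b) :
    IntervalIntegrable (fun r => h r • f r) volume a b := by
  apply hh.smul_continuousOn
  rw [uIcc_of_le hab]
  exact hf.mono (Icc_subset_Icc ha hb)

theorem aux_key {X : Type*} [NormedAddCommGroup X] [NormedSpace ℂ X] [CompleteSpace X]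
    {X₁ : Type*} [NormedAddCommGroup X₁] [NormedSpace ℂ X₁]
    (j : X₁ →L[ℂ] X)
    (hjc : ∀ (c : X₁) (r : ℝ), IsClosed (j '' Metric.closedBall c r))
    (T : ℝ) (f : ℝ → X) (hf : ContinuousOn f (Icc 0 T))
    (g : ℝ → X₁) (hfg : ∀ t ∈ Icc (0:ℝ) T, f t = j (g t))
    (K : ℝ) (hK : ∀ t ∈ Icc (0:ℝ) T, ‖g t‖ ≤ K)
    (a b : ℝ) (ha : 0 ≤ a) (hab : a ≤ b) (hb : b ≤ T) (h : ℝ → ℝ)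
    (hh : IntervalIntegrable h volume a b) (M : ℝ) (hM : ∫ r in a..b, |h r| ≤ M) :
    ∃ x : X₁, j x = ∫ r in a..b, h r • f r ∧ ‖x‖ ≤ M * K := by
  have hM0 : 0 ≤ M := le_trans (intervalIntegral.integral_nonneg hab (fun _ _ => abs_nonneg _)) hM
  have hKK : 0 ≤ K := (norm_nonneg _).trans (hK a ⟨ha, hab.trans hb⟩)
  by_contra hcon
  have hx : (∫ r in a..b, h r • f r) ∉ j '' Metric.closedBall 0 (M * K) := by
    rintro ⟨x, hx, hxe⟩
    exact hcon ⟨x, hxe, by simpa using hx⟩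
  have hconv : Convex ℝ (j '' Metric.closedBall (0 : X₁) (M * K)) := by
    have := (convex_closedBall (0 : X₁) (M * K)).linear_image ((j : X₁ →ₗ[ℂ] X).restrictScalars ℝ)
    simpa using this
  obtain ⟨φ, u, h1, h2⟩ := geometric_hahn_banach_closed_point hconv (hjc 0 (M * K)) hx
  have hint := aux_smul_integrable hf ha hab hb hh
  rw [← ContinuousLinearMap.intervalIntegral_comp_comm φ hint] at h2
  have hu : 0 < u := by
    have := h1 0 ⟨0, by simp; positivity, by simp⟩
    simpa using this
  have hb1 : ∀ r ∈ Icc a b, M * |φ (f r)| ≤ u := by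
    intro r hr
    have hr' : r ∈ Icc 0 T := ⟨ha.trans hr.1, hr.2.trans hb⟩
    have key : ∀ c : ℝ, |c| = M → c * φ (f r) ≤ u := by
      intro c hc
      have := h1 (c • f r) ⟨c • g r, by
        simp only [Metric.mem_closedBall, dist_zero_right, norm_smul, Real.norm_eq_abs, hc]
        exact mul_le_mul_of_nonneg_left (hK r hr') hM0, by
        rw [hfg r hr']; exact ContinuousLinearMap.map_smul_of_tower j c (g r)⟩
      simpa using this.le
    rcases abs_cases (φ (f r)) with ⟨h, -⟩ | ⟨h, -⟩ <;> rw [h]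
    · exact key M (abs_of_nonneg hM0)
    · have := key (-M) (by rw [abs_neg, abs_of_nonneg hM0]); linarith
  have hi2 : IntervalIntegrable (fun r => φ (h r • f r)) volume a b :=
    ⟨φ.integrable_comp hint.1, φ.integrable_comp hint.2⟩
  rcases hM0.eq_or_lt with h0 | h0
  · skip
    obtain ⟨C, hC⟩ := (isCompact_Icc.image_of_continuousOn hf).isBounded.exists_norm_le
    have : ∫ r in a..b, φ (h r • f r) ≤ ∫ r in a..b, (‖φ‖ * C) * |h r| := by
      apply intervalIntegral.integral_mono_on hab hi2 (hh.abs.const_mul _)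
      intro r hr
      have hr' : r ∈ Icc 0 T := ⟨ha.trans hr.1, hr.2.trans hb⟩
      have hc := hC _ ⟨r, hr', rfl⟩
      calc φ (h r • f r) ≤ ‖φ (h r • f r)‖ := Real.le_norm_self _
        _ ≤ ‖φ‖ * ‖h r • f r‖ := φ.le_opNorm _
        _ = ‖φ‖ * ‖f r‖ * |h r| := by rw [norm_smul, Real.norm_eq_abs]; ring
        _ ≤ _ := by gcongr
    rw [intervalIntegral.integral_const_mul] at this
    have h3 : ∫ r in a..b, |h r| = 0 := le_antisymm (by linarith)
      (intervalIntegral.integral_nonneg hab (fun _ _ => abs_nonneg _))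
    rw [h3] at this
    linarith
  · have : ∫ r in a..b, φ (h r • f r) ≤ ∫ r in a..b, (u / M) * |h r| := by
      apply intervalIntegral.integral_mono_on hab hi2 (hh.abs.const_mul _)
      intro r hr
      have := hb1 r hr
      have h5 : |φ (f r)| ≤ u / M := by rw [le_div_iff₀ h0]; linarith
      calc φ (h r • f r) = h r * φ (f r) := by simp
        _ ≤ |h r * φ (f r)| := le_abs_self _
        _ = |φ (f r)| * |h r| := by rw [abs_mul, mul_comm]
        _ ≤ _ := by gcongr
    rw [intervalIntegral.integral_const_mul] at this
    have h4 : u / M * ∫ r in a..b, |h r| ≤ u / M * M := by gcongr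
    rw [div_mul_cancel₀ _ h0.ne'] at h4
    linarith

theorem aux_int (β : ℝ) (hβ : 0 < β) (t a b : ℝ) :
    IntervalIntegrable (fun r => (t - r) ^ (β - 1)) volume a b := by
  have := (intervalIntegral.intervalIntegrable_rpow' (a := t - a) (b := t - b)
    (r := β - 1) (by linarith)).comp_sub_left t
  simpa using this

theorem aux_val (β : ℝ) (hβ : 0 < β) (t a b : ℝ) :
    ∫ r in a..b, (t - r) ^ (β - 1) = ((t - a) ^ β - (t - b) ^ β) / β := by
  rw [intervalIntegral.integral_comp_sub_left (fun x => x ^ (β - 1)) t,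
    integral_rpow (Or.inl (by linarith))]
  simp

theorem aux_holder {X : Type*} [NormedAddCommGroup X] [NormedSpace ℂ X] [CompleteSpace X]
    {X₁ : Type*} [NormedAddCommGroup X₁] [NormedSpace ℂ X₁]
    (j : X₁ →L[ℂ] X)
    (hjc : ∀ (c : X₁) (r : ℝ), IsClosed (j '' Metric.closedBall c r))
    (T : ℝ) (f : ℝ → X) (hf : ContinuousOn f (Icc 0 T))
    (g : ℝ → X₁) (hfg : ∀ t ∈ Icc (0:ℝ) T, f t = j (g t))
    (K : ℝ) (hK : ∀ t ∈ Icc (0:ℝ) T, ‖g t‖ ≤ K) (β : ℝ) (hβ : 0 < β) (hβ1 : β < 1)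
    (s t : ℝ) (hs : 0 ≤ s) (hst : s ≤ t) (ht : t ≤ T) :
    ∃ x : X₁, j x = RL β f t - RL β f s ∧
      ‖x‖ ≤ 2 / Real.Gamma (β + 1) * (t - s) ^ β * K := by
  have hKK : 0 ≤ K := (norm_nonneg _).trans (hK s ⟨hs, hst.trans ht⟩)
  have hG := Real.Gamma_pos_of_pos hβ
  have i1 := aux_int β hβ t 0 s
  have i2 := aux_int β hβ s 0 s
  have i3 := aux_int β hβ t s t
  obtain ⟨x, hx, hxn⟩ := aux_key j hjc T f hf g hfg K hK 0 s le_rfl hs (hst.trans ht)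
    (fun r => (t - r) ^ (β - 1) - (s - r) ^ (β - 1)) (i1.sub i2) ((t - s) ^ β / β) (by
      have : ∫ r in (0:ℝ)..s, |(t - r) ^ (β - 1) - (s - r) ^ (β - 1)|
          = ∫ r in (0:ℝ)..s, ((s - r) ^ (β - 1) - (t - r) ^ (β - 1)) := by
        rw [intervalIntegral.integral_of_le hs, intervalIntegral.integral_of_le hs,
          integral_Ioc_eq_integral_Ioo, integral_Ioc_eq_integral_Ioo]
        apply setIntegral_congr_fun measurableSet_Ioo
        intro r hr
        have : (t - r) ^ (β - 1) ≤ (s - r) ^ (β - 1) :=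
          Real.rpow_le_rpow_of_nonpos (by linarith [hr.2]) (by linarith) (by linarith)
        simp only
        rw [abs_of_nonpos (by linarith)]; ring
      rw [this, intervalIntegral.integral_sub i2 i1, aux_val β hβ, aux_val β hβ]
      have : s ^ β ≤ t ^ β := Real.rpow_le_rpow hs hst hβ.le
      rw [← sub_div]
      gcongr
      simp [Real.zero_rpow hβ.ne']
      linarith)
  obtain ⟨y, hy, hyn⟩ := aux_key j hjc T f hf g hfg K hK s t hs hst ht
    (fun r => (t - r) ^ (β - 1)) i3 ((t - s) ^ β / β) (by
      have : ∫ r in s..t, |(t - r) ^ (β - 1)| = ∫ r in s..t, (t - r) ^ (β - 1) := by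
        apply intervalIntegral.integral_congr
        intro r hr
        rw [uIcc_of_le hst] at hr
        exact abs_of_nonneg (Real.rpow_nonneg (by linarith [hr.2]) _)
      rw [this, aux_val β hβ]
      simp [Real.zero_rpow hβ.ne'])
  refine ⟨(Real.Gamma β)⁻¹ • (x + y), ?_, ?_⟩
  · rw [ContinuousLinearMap.map_smul_of_tower j, map_add, hx, hy, RL, RL, ← smul_sub]
    congr 1
    have a1 := aux_smul_integrable hf le_rfl hs (hst.trans ht) i1
    have a2 := aux_smul_integrable hf le_rfl hs (hst.trans ht) i2
    have a3 := aux_smul_integrable hf hs hst ht i3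
    simp only [sub_smul]
    rw [intervalIntegral.integral_sub a1 a2, ← intervalIntegral.integral_add_adjacent_intervals a1 a3]
    abel
  · rw [norm_smul, norm_inv, Real.norm_of_nonneg hG.le, Real.Gamma_add_one hβ.ne']
    calc (Real.Gamma β)⁻¹ * ‖x + y‖ ≤ (Real.Gamma β)⁻¹ *
          ((t - s) ^ β / β * K + (t - s) ^ β / β * K) := by
          gcongr
          exact (norm_add_le _ _).trans (add_le_add hxn hyn)
      _ = _ := by field_simp; ring

theorem aux_fubini {X : Type*} [NormedAddCommGroup X] [NormedSpace ℂ X] [CompleteSpace X]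
    (T : ℝ) (f : ℝ → X) (hf : ContinuousOn f (Icc 0 T)) (β : ℝ) (hβ : 0 < β)
    (t : ℝ) (ht0 : 0 ≤ t) (ht : t ≤ T) :
    RL (β + 1) f t = ∫ s in (0:ℝ)..t, RL β f s := by
  set F : ℝ → X := (Ioc 0 T).indicator f with hF
  set k : ℝ → ℝ := (Ioc 0 T).indicator (fun x => x ^ (β - 1)) with hk
  have hT : 0 ≤ T := ht0.trans ht
  have hFi : Integrable F := by
    rw [hF, integrable_indicator_iff measurableSet_Ioc]
    exact (hf.integrableOn_Icc).mono_set Ioc_subset_Icc_self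
  have hki : Integrable k := by
    rw [hk, integrable_indicator_iff measurableSet_Ioc,
      ← intervalIntegrable_iff_integrableOn_Ioc_of_le hT]
    exact intervalIntegral.intervalIntegrable_rpow' (by linarith)
  have hprod : Integrable (fun p : ℝ × ℝ => k (p.1 - p.2) • F p.2)
      ((volume.restrict (Ioc 0 t)).prod volume) := by
    have := hFi.convolution_integrand (μ := volume) (ν := volume)
      ((ContinuousLinearMap.lsmul ℝ ℝ : ℝ →L[ℝ] X →L[ℝ] X).flip) hki
    have h2 := this.restrict (s := Ioc 0 t ×ˢ univ)
    rw [← Measure.prod_restrict, Measure.restrict_univ] at h2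
    simpa using h2
  have e1 : ∫ s in (0:ℝ)..t, RL β f s
      = (Real.Gamma β)⁻¹ • ∫ s in Ioc 0 t, ∫ r, k (s - r) • F r := by
    unfold RL
    rw [intervalIntegral.integral_smul, intervalIntegral.integral_of_le ht0]
    congr 1
    apply setIntegral_congr_fun measurableSet_Ioc
    intro s hs
    simp only
    rw [intervalIntegral.integral_of_le hs.1.le, integral_Ioc_eq_integral_Ioo,
      ← integral_indicator measurableSet_Ioo]
    congr 1
    ext r
    by_cases hr : r ∈ Ioo 0 s
    · have h1 : r ∈ Ioc 0 T := ⟨hr.1, by linarith [hr.2, hs.2]⟩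
      have h2 : s - r ∈ Ioc 0 T := ⟨by linarith [hr.2], by linarith [hr.1, hs.2]⟩
      rw [indicator_of_mem hr, hF, hk, indicator_of_mem h1, indicator_of_mem h2]
    · rw [indicator_of_notMem hr]
      by_cases h1 : r ∈ Ioc 0 T
      · have h2 : s - r ∉ Ioc 0 T := fun h => hr ⟨h1.1, by linarith [h.1]⟩
        rw [hk, indicator_of_notMem h2, zero_smul]
      · rw [hF, indicator_of_notMem h1, smul_zero]
  rw [e1, integral_integral_swap hprod, RL, Real.Gamma_add_one hβ.ne',
    intervalIntegral.integral_of_le ht0, mul_inv, mul_comm, mul_smul]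
  congr 1
  rw [← integral_smul, ← integral_indicator measurableSet_Ioc]
  congr 1
  ext r
  rw [integral_smul_const]
  by_cases hr : r ∈ Ioc 0 t
  · have h1 : r ∈ Ioc 0 T := ⟨hr.1, by linarith [hr.2]⟩
    rw [indicator_of_mem hr, hF, indicator_of_mem h1, smul_smul]
    congr 1
    have e2 : ∫ s in Ioc 0 t, k (s - r) = ∫ s in Ioc r t, (s - r) ^ (β - 1) := by
      rw [← integral_indicator measurableSet_Ioc, ← integral_indicator measurableSet_Ioc]
      congr 1
      ext s
      by_cases hs : s ∈ Ioc r t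
      · have h2 : s ∈ Ioc 0 t := ⟨by linarith [hr.1, hs.1], hs.2⟩
        have h3 : s - r ∈ Ioc 0 T := ⟨by linarith [hs.1], by linarith [hs.2, hr.1]⟩
        rw [indicator_of_mem hs, indicator_of_mem h2, hk, indicator_of_mem h3]
      · rw [indicator_of_notMem hs]
        by_cases h2 : s ∈ Ioc 0 t
        · have h3 : s - r ∉ Ioc 0 T := fun h => hs ⟨by linarith [h.1], h2.2⟩
          rw [indicator_of_mem h2, hk, indicator_of_notMem h3]
        · rw [indicator_of_notMem h2]
    rw [e2, ← intervalIntegral.integral_of_le hr.2,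
      intervalIntegral.integral_comp_sub_right (fun x => x ^ (β - 1)) r,
      integral_rpow (Or.inl (by linarith))]
    simp [Real.zero_rpow hβ.ne']
    field_simp
  · rw [indicator_of_notMem hr]
    by_cases h1 : r ∈ Ioc 0 T
    · have : ∫ s in Ioc 0 t, k (s - r) = 0 := by
        apply setIntegral_eq_zero_of_forall_eq_zero
        intro s hs
        have h3 : s - r ∉ Ioc 0 T := fun h => hr ⟨h1.1, by linarith [h.1, hs.2]⟩
        rw [hk, indicator_of_notMem h3]
      rw [this, zero_smul]
    · rw [hF, indicator_of_notMem h1, smul_zero]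

/-- Let `1 < α < 2`, let `j : X₁ → X` be an injective bounded linear map between complex
Banach spaces mapping closed balls of `X₁` onto closed subsets of `X`, and let
`f ∈ C([0,T];X)` take values (via `j`) in a bounded subset of `X₁`, with bound `K`.
Then `u := I^α f` is `C¹` on `[0,T]` with `u(0) = u′(0) = 0` and `u′ = I^{α−1} f`, and
`u′` is `(α−1)`-Hölder continuous with values in `X₁`, with constant `(2/Γ(α)) K`. -/
theorem riemannLiouville_C1_holder_in_smaller_space
    {X : Type*} [NormedAddCommGroup X] [NormedSpace ℂ X] [CompleteSpace X]
    {X₁ : Type*} [NormedAddCommGroup X₁] [NormedSpace ℂ X₁] [CompleteSpace X₁]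
    (j : X₁ →L[ℂ] X) (hj : Function.Injective j)
    (hjc : ∀ (c : X₁) (r : ℝ), IsClosed (j '' Metric.closedBall c r))
    (T : ℝ) (hT : 0 < T) (α : ℝ) (hα : α ∈ Ioo (1:ℝ) 2)
    (f : ℝ → X) (hf : ContinuousOn f (Icc 0 T))
    (g : ℝ → X₁) (hfg : ∀ t ∈ Icc (0:ℝ) T, f t = j (g t))
    (K : ℝ) (hK : ∀ t ∈ Icc (0:ℝ) T, ‖g t‖ ≤ K) :
    -- `u := I^α f` is `C¹` on `[0,T]`, with `u(0) = 0`, derivative `u′ = I^{α−1} f`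
    -- (which is continuous) and `u′(0) = 0`
    RL α f 0 = 0 ∧
    RL (α - 1) f 0 = 0 ∧
    (∀ t ∈ Icc (0:ℝ) T, HasDerivWithinAt (RL α f) (RL (α - 1) f t) (Icc 0 T) t) ∧
    ContinuousOn (RL (α - 1) f) (Icc 0 T) ∧
    -- and `u′` is `(α−1)`-Hölder continuous with values in `X₁`
    (∃ v : ℝ → X₁,
      (∀ t ∈ Icc (0:ℝ) T, j (v t) = RL (α - 1) f t) ∧
      (∀ s ∈ Icc (0:ℝ) T, ∀ t ∈ Icc (0:ℝ) T,
        ‖v t - v s‖ ≤ (2 / Real.Gamma α) * |t - s| ^ (α - 1) * K)) := by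
  obtain ⟨hα1, hα2⟩ := hα
  obtain ⟨β, rfl⟩ : ∃ β, α = β + 1 := ⟨α - 1, by ring⟩
  have hβ : 0 < β := by linarith
  have hβ1 : β < 1 := by linarith
  simp only [add_sub_cancel_right]
  have z : ∀ γ, RL γ f 0 = 0 := fun γ => by simp [RL]
  have H := aux_holder j hjc T f hf g hfg K hK β hβ hβ1
  have hv : ∃ v : ℝ → X₁,
      (∀ t ∈ Icc (0:ℝ) T, j (v t) = RL β f t) ∧
      (∀ s ∈ Icc (0:ℝ) T, ∀ t ∈ Icc (0:ℝ) T,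
        ‖v t - v s‖ ≤ (2 / Real.Gamma (β + 1)) * |t - s| ^ β * K) := by
    have : ∀ t, ∃ x : X₁, t ∈ Icc (0:ℝ) T → j x = RL β f t := by
      intro t
      by_cases ht : t ∈ Icc 0 T
      · obtain ⟨x, hx, -⟩ := H 0 t le_rfl ht.1 ht.2
        exact ⟨x, fun _ => by rw [hx, z, sub_zero]⟩
      · exact ⟨0, fun h => absurd h ht⟩
    choose v hv using this
    have hle : ∀ s ∈ Icc (0:ℝ) T, ∀ t ∈ Icc (0:ℝ) T, s ≤ t →
        ‖v t - v s‖ ≤ (2 / Real.Gamma (β + 1)) * |t - s| ^ β * K := by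
      intro s hs t ht hst
      obtain ⟨x, hx, hxn⟩ := H s t hs.1 hst ht.2
      have : v t - v s = x := hj (by rw [map_sub, hv t ht, hv s hs, hx])
      rw [this, abs_of_nonneg (sub_nonneg.2 hst)]
      exact hxn
    refine ⟨v, hv, fun s hs t ht => ?_⟩
    rcases le_total s t with h | h
    · exact hle s hs t ht h
    · rw [norm_sub_rev, abs_sub_comm]
      exact hle t ht s hs h
  have hcont : ContinuousOn (RL β f) (Icc 0 T) := by
    obtain ⟨v, hv1, hv2⟩ := hv
    have : ContinuousOn v (Icc 0 T) := by
      intro s hs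
      rw [ContinuousWithinAt, tendsto_iff_norm_sub_tendsto_zero]
      have hc : Filter.Tendsto (fun t => (2 / Real.Gamma (β + 1)) * |t - s| ^ β * K)
          (nhdsWithin s (Icc 0 T)) (nhds 0) := by
        have : Continuous (fun t => (2 / Real.Gamma (β + 1)) * |t - s| ^ β * K) := by
          have : Continuous (fun t : ℝ => |t - s| ^ β) :=
            (by fun_prop : Continuous (fun t : ℝ => |t - s|)).rpow_const (fun _ => Or.inr hβ.le)
          fun_prop
        have h := (this.tendsto s).mono_left (nhdsWithin_le_nhds (s := Icc 0 T))
        simpa [Real.zero_rpow hβ.ne'] using h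
      refine squeeze_zero' (Filter.Eventually.of_forall fun _ => norm_nonneg _) ?_ hc
      filter_upwards [self_mem_nhdsWithin] with t ht
      exact hv2 s hs t ht
    exact (j.continuous.comp_continuousOn this).congr (fun t ht => (hv1 t ht).symm)
  refine ⟨z _, z _, ?_, hcont, hv⟩
  intro t ht
  have hd : HasDerivWithinAt (fun t => ∫ s in (0:ℝ)..t, RL β f s) (RL β f t) (Icc 0 T) t := by
    haveI : Fact (t ∈ Icc 0 T) := ⟨ht⟩
    apply intervalIntegral.integral_hasDerivWithinAt_right
    · apply ContinuousOn.intervalIntegrable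
      rw [uIcc_of_le ht.1]
      exact hcont.mono (Icc_subset_Icc le_rfl ht.2)
    · exact hcont.stronglyMeasurableAtFilter_nhdsWithin measurableSet_Icc t
    · exact hcont t ht
  exact hd.congr (fun x hx => aux_fubini T f hf β hβ x hx.1 hx.2)
    (aux_fubini T f hf β hβ t ht.1 ht.2)
end

section
/- Let f ∈ C([0,T];X) and suppose there is a bounded function g : [0,T] → X₁ with f(t) = j(g(t)) for all t, with K := sup_{t∈[0,T]} ‖g(t)‖_{X₁}. Then the primitive u(t) := ∫₀^t f(s) ds is Lipschitz continuous with values in X₁: there exists v : [0,T] → X₁ such that j(v(t)) = u(t) for all t, v(0) = 0, and ‖v(t) − v(s)‖_{X₁} ≤ |t−s| K for all s, t ∈ [0,T]. -/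
open MeasureTheory Set Real

/-- Let `j : X₁ → X` be an injective bounded linear map between complex Banach spaces
mapping closed balls of `X₁` onto closed subsets of `X`, and let `f ∈ C([0,T];X)` take
values (via `j`) in a bounded subset of `X₁`, with bound `K`.  Then the primitive
`u(t) = ∫₀^t f(s) ds` is Lipschitz continuous with values in `X₁`, with Lipschitz
constant `K`. -/
theorem primitive_lipschitz_in_smaller_space
    {X : Type*} [NormedAddCommGroup X] [NormedSpace ℂ X] [CompleteSpace X]
    {X₁ : Type*} [NormedAddCommGroup X₁] [NormedSpace ℂ X₁] [CompleteSpace X₁]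
    (j : X₁ →L[ℂ] X) (hj : Function.Injective j)
    (hjc : ∀ (c : X₁) (r : ℝ), IsClosed (j '' Metric.closedBall c r))
    (T : ℝ) (hT : 0 < T)
    (f : ℝ → X) (hf : ContinuousOn f (Icc 0 T))
    (g : ℝ → X₁) (hfg : ∀ t ∈ Icc (0:ℝ) T, f t = j (g t))
    (K : ℝ) (hK : ∀ t ∈ Icc (0:ℝ) T, ‖g t‖ ≤ K) :
    ∃ v : ℝ → X₁,
      (∀ t ∈ Icc (0:ℝ) T, j (v t) = ∫ s in (0:ℝ)..t, f s) ∧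
      v 0 = 0 ∧
      (∀ s ∈ Icc (0:ℝ) T, ∀ t ∈ Icc (0:ℝ) T, ‖v t - v s‖ ≤ |t - s| * K) := by
  have hint : ∀ a ∈ Icc (0:ℝ) T, ∀ b ∈ Icc (0:ℝ) T, IntervalIntegrable f volume a b := by
    intro a ha b hb
    exact (hf.mono (uIcc_subset_Icc ha hb)).intervalIntegrable
  have key : ∀ a ∈ Icc (0:ℝ) T, ∀ b ∈ Icc (0:ℝ) T, a ≤ b →
      ∃ w : X₁, j w = (∫ s in a..b, f s) ∧ ‖w‖ ≤ (b - a) * K := by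
    intro a ha b hb hab
    rcases hab.eq_or_lt with rfl | hlt
    · exact ⟨0, by simp, by simp⟩
    have hconv : Convex ℝ (j '' Metric.closedBall (0 : X₁) K) := by
      have := (convex_closedBall (0 : X₁) K).linear_image
        ((j.restrictScalars ℝ : X₁ →L[ℝ] X) : X₁ →ₗ[ℝ] X)
      exact this
    have hmem : (⨍ x in Ioc a b, f x) ∈ j '' Metric.closedBall (0 : X₁) K := by
      apply hconv.set_average_mem (hjc 0 K)
      · simpa using hlt
      · simp
      · refine (ae_restrict_iff' measurableSet_Ioc).2 (Filter.Eventually.of_forall ?_)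
        intro x hx
        have hx' : x ∈ Icc (0:ℝ) T := ⟨ha.1.trans hx.1.le, hx.2.trans hb.2⟩
        exact ⟨g x, by simpa using hK x hx', (hfg x hx').symm⟩
      · exact (intervalIntegrable_iff_integrableOn_Ioc_of_le hab).1 (hint a ha b hb)
    obtain ⟨w, hw, hjw⟩ := hmem
    have hpos : 0 < b - a := sub_pos.2 hlt
    rw [← uIoc_of_le hab, interval_average_eq] at hjw
    refine ⟨(b - a) • w, ?_, ?_⟩
    · have h1 : j ((b - a) • w) = (b - a) • j w :=
        (j.restrictScalars ℝ : X₁ →L[ℝ] X).map_smul (b - a) w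
      rw [h1, hjw, smul_inv_smul₀ hpos.ne']
    · rw [norm_smul, Real.norm_of_nonneg hpos.le]
      exact mul_le_mul_of_nonneg_left (by simpa using hw) hpos.le
  have h0 : (0:ℝ) ∈ Icc (0:ℝ) T := ⟨le_rfl, hT.le⟩
  have hex : ∀ t : ℝ, ∃ w : X₁, t ∈ Icc (0:ℝ) T → j w = ∫ s in (0:ℝ)..t, f s := by
    intro t
    by_cases ht : t ∈ Icc (0:ℝ) T
    · obtain ⟨w, hw, -⟩ := key 0 h0 t ht ht.1
      exact ⟨w, fun _ => hw⟩
    · exact ⟨0, fun h => absurd h ht⟩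
  choose v hv using hex
  have hle : ∀ s ∈ Icc (0:ℝ) T, ∀ t ∈ Icc (0:ℝ) T, s ≤ t → ‖v t - v s‖ ≤ (t - s) * K := by
    intro s hs t ht hst
    obtain ⟨w, hw, hwn⟩ := key s hs t ht hst
    have : v t - v s = w := by
      apply hj
      rw [map_sub, hv t ht, hv s hs, hw]
      exact intervalIntegral.integral_interval_sub_left (hint 0 h0 t ht) (hint 0 h0 s hs)
    rw [this]
    exact hwn
  refine ⟨v, hv, ?_, ?_⟩
  · apply hj
    rw [hv 0 h0]
    simp
  · intro s hs t ht
    rcases le_total s t with h | h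
    · rw [abs_of_nonneg (sub_nonneg.2 h)]
      exact hle s hs t ht h
    · rw [norm_sub_rev, abs_sub_comm, abs_of_nonneg (sub_nonneg.2 h)]
      exact hle t ht s hs h
end
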